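/- Let ρ : ℝ → ℝ be real analytic and non-polynomial on an open interval (α, β) with α < β, and suppose in addition that ρ is twice continuously differentiable on a neighborhood of some point x_0 ∈ ℝ with ρ''(x_0) ≠ 0. Let f : [0, 1/2] → ℝ be continuous and let ε > 0. Then there exist a positive integer K, a real δ ≠ 0, and real numbers u_i, v_i, w_i, w_{0,i} for i = 1, 2, 3, 4, such that for every x ∈ [0, 1/2], | Σ_{i=1}^{4} Γ_δ( φ_i(x + i/(4K)), ψ̃(2Kx + i/2) ) − f(x) | < ε, where φ_i(t) := u_i·g( w_i·ρ( (α+β)/2 + (ψ(2Kt)/2 + 1)·w_{0,i} ) ) + v_i and Γ_δ(x, y) := ( ρ(x_0 + δx + δy) − ρ(x_0 + δy) − ρ(x_0 + δx) + ρ(x_0) ) / ( δ²·ρ''(x_0) ). -/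

import Mathlib

open Set

/-- The 2-periodic triangle wave `g(x) = |x - 2⌊(x+1)/2⌋|`. -/
noncomputable def triWave (x : ℝ) : ℝ := |x - 2 * (⌊(x + 1) / 2⌋ : ℤ)|

/-- `ψ(x) = x - g(x)`. -/
noncomputable def psiFun (x : ℝ) : ℝ := x - triWave x

/-- `ψ̃(x) = g(x + 1 - g(x + 1))`. -/
noncomputable def psiTilde (x : ℝ) : ℝ := triWave (x + 1 - triWave (x + 1))

section Helpers
open MeasureTheory Filter Topology


noncomputable def torusMeas (d : Type*) [Fintype d] : Measure (UnitAddTorus d) :=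
  Measure.pi (fun _ => (AddCircle.haarAddCircle : Measure UnitAddCircle))

instance torusMeas_prob (d : Type*) [Fintype d] : IsProbabilityMeasure (torusMeas d) := by
  unfold torusMeas; infer_instance

instance torusMeas_openPos (d : Type*) [Fintype d] : (torusMeas d).IsOpenPosMeasure := by
  unfold torusMeas; infer_instance

lemma integral_fourier_ne {n : ℤ} (hn : n ≠ 0) :
    ∫ x : UnitAddCircle, fourier n x ∂AddCircle.haarAddCircle = 0 :=
  integral_eq_zero_of_add_right_eq_neg (μ := AddCircle.haarAddCircle)
      (fourier_add_half_inv_index hn one_pos)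

lemma integral_mFourier_ne {d : Type*} [Fintype d] {n : d → ℤ} (hn : n ≠ 0) :
    ∫ x, UnitAddTorus.mFourier n x ∂(torusMeas d) = 0 := by
  unfold torusMeas
  rw [UnitAddTorus.mFourier, ContinuousMap.coe_mk]
  rw [MeasureTheory.integral_fintype_prod_eq_prod (fun i (x : UnitAddCircle) => (fourier (n i) x : ℂ))]
  obtain ⟨i, hi⟩ := Function.ne_iff.mp hn
  exact Finset.prod_eq_zero (Finset.mem_univ i) (integral_fourier_ne hi)

/-- the linear flow on the torus -/
def torusFlow {d : Type*} (a : d → ℝ) (t : ℝ) : UnitAddTorus d := fun i => ((t * a i : ℝ) : UnitAddCircle)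

lemma continuous_torusFlow {d : Type*} (a : d → ℝ) : Continuous (torusFlow a) := by
  refine continuous_pi fun i => ?_
  exact (AddCircle.continuous_mk' 1).comp (by fun_prop)

lemma mFourier_torusFlow {d : Type*} [Fintype d] (a : d → ℝ) (n : d → ℤ) (t : ℝ) :
    UnitAddTorus.mFourier n (torusFlow a t) =
      Complex.exp ((2 * Real.pi * Complex.I * ((∑ i, (n i : ℝ) * a i : ℝ) : ℂ)) * t) := by
  simp only [UnitAddTorus.mFourier, ContinuousMap.coe_mk, torusFlow, fourier_coe_apply]
  rw [← Complex.exp_sum]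
  congr 1
  push_cast
  rw [Finset.mul_sum, Finset.sum_mul]
  refine Finset.sum_congr rfl fun i _ => ?_
  simp; ring

lemma mean_mFourier {d : Type*} [Fintype d] (a : d → ℝ)
    (ha : ∀ m : d → ℤ, ∑ i, (m i : ℝ) * a i = 0 → m = 0) (n : d → ℤ) :
    Tendsto (fun T : ℝ => (T : ℂ)⁻¹ * ∫ t in (0:ℝ)..T, UnitAddTorus.mFourier n (torusFlow a t))
      atTop (𝓝 (∫ x, UnitAddTorus.mFourier n x ∂(torusMeas d))) := by
  by_cases hn : n = 0
  · subst hn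
    refine Tendsto.congr' (f₁ := fun _ => 1) ?_ ?_
    · filter_upwards [eventually_gt_atTop 0] with T hT
      simp [UnitAddTorus.mFourier_zero, hT.ne']
    · simp [UnitAddTorus.mFourier_zero]
  · rw [integral_mFourier_ne hn]
    have hl : ∑ i, (n i : ℝ) * a i ≠ 0 := fun h => hn (ha n h)
    set l := ∑ i, (n i : ℝ) * a i with hldef
    set c : ℂ := 2 * Real.pi * Complex.I * (l : ℂ) with hc
    have hc0 : c ≠ 0 := by
      simp [hc, hl, Real.pi_ne_zero]
    have h1 : ∀ T : ℝ, ‖(T : ℂ)⁻¹ * ∫ t in (0:ℝ)..T, UnitAddTorus.mFourier n (torusFlow a t)‖ ≤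
        |T⁻¹| * (2 / ‖c‖) := by
      intro T
      simp_rw [mFourier_torusFlow]
      rw [← hldef, ← hc, integral_exp_mul_complex hc0, norm_mul, norm_div]
      have e1 : ∀ s : ℝ, ‖Complex.exp (c * s)‖ = 1 := by
        intro s
        have : c * s = ((2 * Real.pi * l * s : ℝ) : ℂ) * Complex.I := by
          rw [hc]; push_cast; ring
        rw [this, Complex.norm_exp_ofReal_mul_I]
      have e2 : ‖Complex.exp (c * T) - Complex.exp (c * (0:ℝ))‖ ≤ 2 := by
        refine (norm_sub_le _ _).trans ?_
        rw [e1, e1]; norm_num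
      have e3 : ‖(T:ℂ)⁻¹‖ = |T⁻¹| := by simp
      rw [e3]
      gcongr
    refine squeeze_zero_norm h1 ?_
    have : Tendsto (fun T : ℝ => |T⁻¹| * (2 / ‖c‖)) atTop (𝓝 (|0| * (2 / ‖c‖))) :=
      (tendsto_inv_atTop_zero.abs).mul_const _
    simpa using this

lemma mean_span {d : Type*} [Fintype d] (a : d → ℝ)
    (ha : ∀ m : d → ℤ, ∑ i, (m i : ℝ) * a i = 0 → m = 0) (P : C(UnitAddTorus d, ℂ))
    (hP : P ∈ Submodule.span ℂ (range (UnitAddTorus.mFourier (d := d)))) :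
    Tendsto (fun T : ℝ => (T : ℂ)⁻¹ * ∫ t in (0:ℝ)..T, P (torusFlow a t))
      atTop (𝓝 (∫ x, P x ∂(torusMeas d))) := by
  have hint : ∀ P : C(UnitAddTorus d, ℂ), Integrable P (torusMeas d) := fun P =>
    P.continuous.integrable_of_hasCompactSupport (HasCompactSupport.of_compactSpace _)
  have hint' : ∀ (P : C(UnitAddTorus d, ℂ)) (T : ℝ),
      IntervalIntegrable (fun t => P (torusFlow a t)) volume 0 T := fun P T =>
    (P.continuous.comp (continuous_torusFlow a)).intervalIntegrable _ _
  induction hP using Submodule.span_induction with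
  | mem x h => obtain ⟨n, rfl⟩ := h; exact mean_mFourier a ha n
  | zero => simp
  | add x y hx hy h1 h2 =>
    simp only [ContinuousMap.add_apply]
    rw [integral_add (hint x) (hint y)]
    refine (h1.add h2).congr fun T => ?_
    rw [intervalIntegral.integral_add (hint' x T) (hint' y T)]; ring
  | smul c x hx h1 =>
    simp only [ContinuousMap.smul_apply, smul_eq_mul]
    rw [integral_const_mul]
    refine (h1.const_mul c).congr fun T => ?_
    rw [intervalIntegral.integral_const_mul]; ring

lemma torusFlow_dense {d : Type*} [Fintype d] (a : d → ℝ)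
    (ha : ∀ m : d → ℤ, ∑ i, (m i : ℝ) * a i = 0 → m = 0) (θ : UnitAddTorus d) {η : ℝ} (hη : 0 < η) :
    ∃ t : ℝ, dist (torusFlow a t) θ < η := by
  by_contra! hcon
  let F : C(UnitAddTorus d, ℂ) := ⟨fun x => ((max 0 (η - dist x θ) : ℝ) : ℂ), by fun_prop⟩
  have hF0 : ∀ t, F (torusFlow a t) = 0 := by
    intro t
    have := hcon t
    simp only [F, ContinuousMap.coe_mk]
    rw [max_eq_left (by linarith)]; simp
  have hpos : 0 < ∫ x, max 0 (η - dist x θ) ∂(torusMeas d) := by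
    refine Continuous.integral_pos_of_hasCompactSupport_nonneg_nonzero (x := θ) (by fun_prop)
      (HasCompactSupport.of_compactSpace _) (fun x => le_max_left _ _) ?_
    simp [hη.le, hη.ne']
  set I := ∫ x, max 0 (η - dist x θ) ∂(torusMeas d) with hI
  have hFI : ∫ x, F x ∂(torusMeas d) = (I : ℂ) := by
    rw [hI, ← integral_complex_ofReal]; rfl
  have hmem : F ∈ closure ((Submodule.span ℂ (range (UnitAddTorus.mFourier (d := d))) :
      Submodule ℂ C(UnitAddTorus d, ℂ)) : Set C(UnitAddTorus d, ℂ)) := by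
    rw [← Submodule.topologicalClosure_coe, UnitAddTorus.span_mFourier_closure_eq_top]
    trivial
  obtain ⟨P, hP, hPF⟩ := Metric.mem_closure_iff.1 hmem (I / 3) (by positivity)
  have hlim := mean_span a ha P hP
  have hptw : ∀ x, ‖F x - P x‖ ≤ I / 3 := fun x => by
    rw [← dist_eq_norm]
    exact (ContinuousMap.dist_apply_le_dist x).trans hPF.le
  have hint : ∀ P : C(UnitAddTorus d, ℂ), Integrable P (torusMeas d) := fun P =>
    P.continuous.integrable_of_hasCompactSupport (HasCompactSupport.of_compactSpace _)
  have h1 : ‖∫ x, P x ∂(torusMeas d)‖ ≤ I / 3 := by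
    refine le_of_tendsto hlim.norm ?_
    filter_upwards [eventually_gt_atTop 0] with T hT
    have : ‖∫ t in (0:ℝ)..T, P (torusFlow a t)‖ ≤ I / 3 * |T - 0| := by
      refine intervalIntegral.norm_integral_le_of_norm_le_const fun t _ => ?_
      have := hptw (torusFlow a t)
      rw [hF0] at this
      simpa using this
    rw [norm_mul, norm_inv, Complex.norm_real, Real.norm_eq_abs]
    rw [sub_zero] at this
    rw [inv_mul_le_iff₀ (abs_pos.2 hT.ne')]
    linarith
  have h2 : ‖(I : ℂ) - ∫ x, P x ∂(torusMeas d)‖ ≤ I / 3 := by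
    rw [← hFI, ← integral_sub (hint F) (hint P)]
    refine (norm_integral_le_of_norm_le_const (Eventually.of_forall hptw)).trans ?_
    simp
  have h3 : ‖(I : ℂ)‖ = I := by rw [Complex.norm_real, Real.norm_eq_abs, abs_of_pos hpos]
  have h4 := norm_le_norm_sub_add (I : ℂ) (∫ x, P x ∂(torusMeas d))
  linarith

/-- Kronecker's theorem (continuous time). -/
lemma kronecker {d : Type*} [Fintype d] (a : d → ℝ)
    (ha : ∀ m : d → ℤ, ∑ i, (m i : ℝ) * a i = 0 → m = 0) (θ : d → ℝ) {η : ℝ} (hη : 0 < η) :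
    ∃ t : ℝ, ∀ i, ∃ n : ℤ, |t * a i - θ i - n| < η := by
  obtain ⟨t, ht⟩ := torusFlow_dense a ha (fun i => (θ i : UnitAddCircle)) hη
  refine ⟨t, fun i => ⟨round (t * a i - θ i), ?_⟩⟩
  have := (dist_le_pi_dist (torusFlow a t) (fun i => (θ i : UnitAddCircle)) i).trans_lt ht
  rw [dist_eq_norm] at this
  simp only [torusFlow] at this
  rw [← AddCircle.coe_sub, UnitAddCircle.norm_eq] at this
  exact this


/-- power sums with distinct positive nodes cannot vanish for infinitely many exponents -/
lemma powerSum_ne {N : ℕ} (m : Fin N → ℤ) (hm : m ≠ 0)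
    (h : ∃ᶠ j : ℕ in atTop, ∑ k : Fin N, (m k : ℝ) * ((k : ℕ) + 1 : ℝ) ^ j = 0) : False := by
  obtain ⟨k1, hk1⟩ := Function.ne_iff.mp hm
  have hne : (Finset.univ.filter fun k => m k ≠ 0).Nonempty := ⟨k1, by simpa using hk1⟩
  obtain ⟨k0, hk0, hmax⟩ := Finset.exists_max_image _ (fun k : Fin N => k) hne
  simp only [Finset.mem_filter, Finset.mem_univ, true_and] at hk0 hmax
  have hlim : Tendsto (fun j : ℕ => ∑ k : Fin N, (m k : ℝ) *
      (((k : ℕ) + 1 : ℝ) / ((k0 : ℕ) + 1 : ℝ)) ^ j) atTop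
      (𝓝 (∑ k : Fin N, if k = k0 then (m k0 : ℝ) else 0)) := by
    refine tendsto_finsetSum _ fun k _ => ?_
    by_cases hk : k = k0
    · subst hk
      have : ((k : ℕ) + 1 : ℝ) ≠ 0 := by positivity
      simp [div_self this]
    · rw [if_neg hk]
      by_cases hmk : m k = 0
      · simp [hmk]
      · have hlt : k < k0 := lt_of_le_of_ne (hmax k hmk) hk
        have hlt' : ((k : ℕ) : ℝ) < (k0 : ℕ) := by exact_mod_cast hlt
        have := tendsto_pow_atTop_nhds_zero_of_lt_one (r := ((k : ℕ) + 1 : ℝ) / ((k0 : ℕ) + 1 : ℝ))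
          (by positivity) (by rw [div_lt_one (by positivity)]; linarith)
        simpa using this.const_mul (m k : ℝ)
  have h0 : (m k0 : ℝ) ≠ 0 := by exact_mod_cast hk0
  have hev := hlim.eventually_ne (b₂ := (0:ℝ)) (by simpa using hk0)
  refine (h.and_eventually hev).exists.elim ?_
  rintro j ⟨hj, hj'⟩
  apply hj'
  simp_rw [div_pow, mul_div_assoc']
  rw [← Finset.sum_div, hj, zero_div]

lemma combo_not_zero {ρ : ℝ → ℝ} {c : ℝ} (hρ : AnalyticAt ℝ ρ c)
    (hnp : ¬ ∃ p : Polynomial ℝ, ∀ᶠ x in 𝓝 c, ρ x = p.eval x)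
    {N : ℕ} (m : Fin N → ℤ) (hm : m ≠ 0) :
    ¬ ∀ᶠ z in 𝓝 (0:ℝ), ∑ k : Fin N, (m k : ℝ) * ρ (c + ((k : ℕ) + 1) * z) = 0 := by
  intro hz
  obtain ⟨p, hp⟩ := hρ
  rw [hasFPowerSeriesAt_iff] at hp
  have hk : ∀ k : Fin N, ∀ᶠ z in 𝓝 (0:ℝ), HasSum (fun n => (((k : ℕ) + 1 : ℝ) * z) ^ n • p.coeff n)
      (ρ (c + ((k : ℕ) + 1) * z)) := by
    intro k
    have : Tendsto (fun z : ℝ => ((k : ℕ) + 1 : ℝ) * z) (𝓝 0) (𝓝 0) := by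
      have : Continuous (fun z : ℝ => ((k : ℕ) + 1 : ℝ) * z) := by fun_prop
      simpa using this.tendsto 0
    exact this.eventually hp
  have hq : HasFPowerSeriesAt (fun z => ∑ k : Fin N, (m k : ℝ) * ρ (c + ((k : ℕ) + 1) * z))
      (FormalMultilinearSeries.ofScalars ℝ
        (fun n => p.coeff n * ∑ k : Fin N, (m k : ℝ) * ((k : ℕ) + 1 : ℝ) ^ n)) 0 := by
    rw [hasFPowerSeriesAt_iff]
    filter_upwards [eventually_all.2 hk] with z hz
    simp only [zero_add, FormalMultilinearSeries.coeff_ofScalars]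
    have := hasSum_sum (s := Finset.univ) fun k (_ : k ∈ (Finset.univ : Finset (Fin N))) =>
      (hz k).mul_left (m k : ℝ)
    refine this.congr_fun fun n => ?_
    simp only [smul_eq_mul]
    rw [Finset.mul_sum, Finset.mul_sum]
    refine Finset.sum_congr rfl fun k _ => ?_
    rw [mul_pow]; ring
  have hq0 := hq.eq_zero_of_eventually hz
  have hcoef : ∀ n, p.coeff n * ∑ k : Fin N, (m k : ℝ) * ((k : ℕ) + 1 : ℝ) ^ n = 0 := by
    intro n
    have := congrArg (fun q => FormalMultilinearSeries.coeff q n) hq0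
    simp only [FormalMultilinearSeries.coeff_ofScalars] at this
    rw [this]; rfl
  apply powerSum_ne m hm
  by_contra hfr
  rw [not_frequently, eventually_atTop] at hfr
  obtain ⟨J, hJ⟩ := hfr
  apply hnp
  refine ⟨∑ n ∈ Finset.range J, Polynomial.C (p.coeff n) * (Polynomial.X - Polynomial.C c) ^ n, ?_⟩
  have hsub : Tendsto (fun x : ℝ => x - c) (𝓝 c) (𝓝 0) := by
    have : Continuous (fun x : ℝ => x - c) := by fun_prop
    simpa using this.tendsto c
  filter_upwards [hsub.eventually hp] with x hx
  rw [add_sub_cancel] at hx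
  have h2 : HasSum (fun n => (x - c) ^ n • p.coeff n) (∑ n ∈ Finset.range J, (x - c) ^ n • p.coeff n) :=
    hasSum_sum_of_ne_finset_zero (fun n hn => by
      have := (mul_eq_zero.1 (hcoef n)).resolve_right (hJ n (by simpa using hn))
      simp [this])
  rw [hx.unique h2]
  simp [Polynomial.eval_finsetSum, mul_comm]

lemma exists_indep {ρ : ℝ → ℝ} {α β : ℝ} (hαβ : α < β)
    (hanal : AnalyticOnNhd ℝ ρ (Ioo α β))
    (hnonpoly : ¬ ∃ p : Polynomial ℝ, ∀ x ∈ Ioo α β, ρ x = p.eval x) (N : ℕ) :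
    ∃ w : ℝ, ∀ m : Fin N → ℤ,
      ∑ k : Fin N, (m k : ℝ) * ρ ((α + β) / 2 + ((k : ℕ) + 1) * w) = 0 → m = 0 := by
  have hc : (α + β) / 2 ∈ Ioo α β := ⟨by linarith, by linarith⟩
  have hnp : ¬ ∃ p : Polynomial ℝ, ∀ᶠ x in 𝓝 ((α + β) / 2), ρ x = p.eval x := by
    rintro ⟨p, hp⟩
    apply hnonpoly
    refine ⟨p, fun x hx => ?_⟩
    have hpa : AnalyticOnNhd ℝ (fun x => p.eval x) (Ioo α β) := fun x _ => by
      simpa using AnalyticAt.aeval_polynomial (analyticAt_id (𝕜 := ℝ) (z := x)) p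
    exact hanal.eqOn_of_preconnected_of_eventuallyEq hpa isPreconnected_Ioo hc hp hx
  set r : ℝ := (β - α) / (4 * (N + 1)) with hr
  have hr0 : 0 < r := div_pos (by linarith) (by positivity)
  have hin : ∀ k : Fin N, ∀ z ∈ Icc (-r) r, (α + β) / 2 + ((k : ℕ) + 1) * z ∈ Ioo α β := by
    intro k z hz
    have h1 : |z| ≤ r := abs_le.2 hz
    have hkN : ((k : ℕ) : ℝ) + 1 ≤ N + 1 := by
      have : (k : ℕ) ≤ N := k.2.le
      have : ((k : ℕ) : ℝ) ≤ N := by exact_mod_cast this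
      linarith
    have h2 : |((k : ℕ) + 1 : ℝ) * z| ≤ (N + 1) * r := by
      rw [abs_mul, abs_of_pos (by positivity : (0:ℝ) < (k : ℕ) + 1)]
      gcongr
    have h3 : ((N : ℝ) + 1) * r = (β - α) / 4 := by rw [hr]; field_simp
    rw [h3, abs_le] at h2
    constructor <;> linarith [h2.1, h2.2]
  have hfin : ∀ m : Fin N → ℤ, m ≠ 0 →
      {z ∈ Icc (-r) r | ∑ k : Fin N, (m k : ℝ) * ρ ((α + β) / 2 + ((k : ℕ) + 1) * z) = 0}.Finite := by
    intro m hm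
    have han : AnalyticOnNhd ℝ
        (fun z => ∑ k : Fin N, (m k : ℝ) * ρ ((α + β) / 2 + ((k : ℕ) + 1) * z)) (Icc (-r) r) := by
      intro z hz
      refine Finset.analyticAt_fun_sum _ fun k _ => ?_
      refine analyticAt_const.mul ?_
      exact AnalyticAt.fun_comp (hanal _ (hin k z hz)) (by fun_prop)
    rcases han.eqOn_zero_or_eventually_ne_zero_of_preconnected isPreconnected_Icc with h | h
    · exfalso
      refine combo_not_zero (hanal _ hc) hnp m hm ?_
      filter_upwards [Icc_mem_nhds (by linarith : -r < 0) hr0] with z hz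
      exact h hz
    · have := isCompact_Icc.finite_sdiff_of_mem_codiscreteWithin h
      refine this.subset fun z hz => ⟨hz.1, ?_⟩
      simpa using hz.2
  have hcount : (⋃ m : {m : Fin N → ℤ // m ≠ 0},
      {z ∈ Icc (-r) r | ∑ k : Fin N, (m.1 k : ℝ) * ρ ((α + β) / 2 + ((k : ℕ) + 1) * z) = 0}).Countable :=
    countable_iUnion fun m => (hfin m.1 m.2).countable
  have hunc : ¬ (Icc (-r) r).Countable := by
    rw [Cardinal.Real.Icc_countable_iff]; linarith
  by_contra! hcon
  apply hunc
  refine hcount.mono fun z hz => ?_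
  obtain ⟨m, hm, hm0⟩ := hcon z
  exact mem_iUnion.2 ⟨⟨m, hm0⟩, hz, hm⟩

lemma gamma_approx {ρ : ℝ → ℝ} {x₀ : ℝ} (hsmooth : ∃ s ∈ nhds x₀, ContDiffOn ℝ 2 ρ s)
    (hρ'' : deriv (deriv ρ) x₀ ≠ 0) {R η : ℝ} (hR : 0 < R) (hη : 0 < η) :
    ∃ δ : ℝ, δ ≠ 0 ∧ ∀ a b : ℝ, |a| ≤ R → |b| ≤ R →
      |(ρ (x₀ + δ * a + δ * b) - ρ (x₀ + δ * b) - ρ (x₀ + δ * a) + ρ x₀) /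
                (δ ^ 2 * deriv (deriv ρ) x₀) - a * b| ≤ η := by
  obtain ⟨s, hs, hcd⟩ := hsmooth
  set D := deriv (deriv ρ) x₀ with hD
  obtain ⟨r, hr, hball⟩ := Metric.mem_nhds_iff.1 hs
  have hdiff : ∀ x ∈ Metric.ball x₀ r, HasDerivAt ρ (deriv ρ x) x := by
    intro x hx
    have : s ∈ 𝓝 x := mem_of_superset (Metric.isOpen_ball.mem_nhds hx) hball
    exact ((hcd.contDiffAt this).differentiableAt (by norm_num)).hasDerivAt
  have hd2 : HasDerivAt (deriv ρ) D x₀ := (differentiableAt_of_deriv_ne_zero hρ'').hasDerivAt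
  have hlo : (fun x => deriv ρ x - deriv ρ x₀ - D * (x - x₀)) =o[𝓝[Metric.ball x₀ r] x₀]
      fun x => (x - x₀) ^ 1 := by
    have := hd2.isLittleO
    refine (this.mono nhdsWithin_le_nhds).congr (fun x => ?_) (fun x => by ring)
    simp [mul_comm]
  have key := Convex.isLittleO_pow_succ_real (convex_ball x₀ r) (Metric.mem_ball_self hr)
    (f := fun x => ρ x - deriv ρ x₀ * (x - x₀) - D / 2 * (x - x₀) ^ 2) (fun x hx => by
      have h1 := hdiff x hx
      have h2 : HasDerivAt (fun x : ℝ => x - x₀) 1 x := (hasDerivAt_id x).sub_const x₀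
      have h3 := (h1.sub (h2.const_mul (deriv ρ x₀))).sub ((h2.pow 2).const_mul (D / 2))
      refine HasDerivAt.hasDerivWithinAt (h3.congr_deriv ?_)
      simp; ring) hlo
  rw [nhdsWithin_eq_nhds.2 (Metric.ball_mem_nhds x₀ hr)] at key
  have hDpos : 0 < |D| := abs_pos.2 hρ''
  set c := η * |D| / (12 * R ^ 2) with hc
  have hcpos : 0 < c := by positivity
  obtain ⟨e, he, hbd⟩ := Metric.eventually_nhds_iff.1 (Asymptotics.isLittleO_iff.1 key hcpos)
  set δ := e / (4 * R) with hδ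
  have hδpos : 0 < δ := by positivity
  have hδe : δ * (2 * R) < e := by rw [hδ]; field_simp; linarith
  refine ⟨δ, hδpos.ne', fun a b ha hb => ?_⟩
  have hrem : ∀ h : ℝ, |h| ≤ 2 * R →
      |ρ (x₀ + δ * h) - deriv ρ x₀ * (δ * h) - D / 2 * (δ * h) ^ 2 - ρ x₀| ≤ c * (δ * (2 * R)) ^ 2 := by
    intro h hh
    have h1 : |δ * h| ≤ δ * (2 * R) := by
      rw [abs_mul, abs_of_pos hδpos]; gcongr
    have h2 := hbd (y := x₀ + δ * h) (by
      rw [Real.dist_eq, add_sub_cancel_left]; linarith)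
    simp only [add_sub_cancel_left, sub_self, mul_zero, sub_zero, Real.norm_eq_abs] at h2
    rw [zero_pow (by norm_num), mul_zero, sub_zero] at h2
    refine h2.trans ?_
    rw [abs_pow]
    rw [show (1 + 1 : ℕ) = 2 from rfl]
    gcongr
  have r1 := hrem (a + b) ((abs_add_le a b).trans (by linarith))
  have r2 := hrem a (by linarith)
  have r3 := hrem b (by linarith)
  have hid : (ρ (x₀ + δ * a + δ * b) - ρ (x₀ + δ * b) - ρ (x₀ + δ * a) + ρ x₀) /
                (δ ^ 2 * D) - a * b = ((ρ (x₀ + δ * (a + b)) - deriv ρ x₀ * (δ * (a + b)) -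
                D / 2 * (δ * (a + b)) ^ 2 - ρ x₀)
      - (ρ (x₀ + δ * a) - deriv ρ x₀ * (δ * a) - D / 2 * (δ * a) ^ 2 - ρ x₀)
      - (ρ (x₀ + δ * b) - deriv ρ x₀ * (δ * b) - D / 2 * (δ * b) ^ 2 - ρ x₀)) / (δ ^ 2 * D) := by
    rw [show x₀ + δ * (a + b) = x₀ + δ * a + δ * b by ring]
    field_simp
    ring
  rw [hid, abs_div, abs_mul, abs_of_pos (by positivity : 0 < δ ^ 2), div_le_iff₀ (by positivity)]
  have hfin : 3 * (c * (δ * (2 * R)) ^ 2) = η * (δ ^ 2 * |D|) := by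
    rw [hc]; field_simp; ring
  rw [← hfin]
  rw [abs_le] at r1 r2 r3 ⊢
  constructor <;> linarith [r1.1, r1.2, r2.1, r2.2, r3.1, r3.2]

lemma triWave_eq {x : ℝ} (n : ℤ) (h : |x - 2 * n| ≤ 1) : triWave x = |x - 2 * n| := by
  unfold triWave
  rw [abs_le] at h
  rcases eq_or_lt_of_le h.2 with h2 | h2
  · have : ⌊(x + 1) / 2⌋ = n + 1 := by
      rw [Int.floor_eq_iff]; push_cast; constructor <;> linarith
    rw [this, h2]; push_cast
    rw [show x - 2 * ((n:ℝ) + 1) = -1 by linarith]; simp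
  · have : ⌊(x + 1) / 2⌋ = n := by
      rw [Int.floor_eq_iff]; constructor <;> linarith [h.1]
    rw [this]

lemma triWave_nonneg (x : ℝ) : 0 ≤ triWave x := abs_nonneg _

lemma triWave_le_one (x : ℝ) : triWave x ≤ 1 := by
  unfold triWave
  have h1 := Int.floor_le ((x + 1) / 2)
  have h2 := Int.lt_floor_add_one ((x + 1) / 2)
  rw [abs_le]; constructor <;> linarith

lemma triWave_sub_le {x τ : ℝ} (n : ℤ) (h0 : 0 ≤ τ) (h1 : τ ≤ 1) :
    |triWave x - τ| ≤ |x - τ - 2 * n| := by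
  have g1 := triWave_le_one x
  have g0 := triWave_nonneg x
  have hf := Int.floor_le ((x + 1) / 2)
  have hf' := Int.lt_floor_add_one ((x + 1) / 2)
  have hg : triWave x = |x - 2 * (⌊(x + 1) / 2⌋ : ℤ)| := rfl
  generalize ⌊(x + 1) / 2⌋ = m at *
  rcases lt_trichotomy m n with h | h | h
  · have : (m : ℝ) + 1 ≤ n := by exact_mod_cast h
    rw [abs_of_nonpos (by linarith : x - τ - 2 * n ≤ 0), abs_le]
    constructor <;> linarith
  · subst h
    rw [hg]
    have := abs_abs_sub_abs_le (x - 2 * m) τ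
    rw [abs_of_nonneg h0] at this
    rwa [show x - τ - 2 * m = x - 2 * m - τ by ring]
  · have : (n : ℝ) + 1 ≤ m := by exact_mod_cast h
    have h3 := neg_abs_le (x - 2 * m)
    rw [← hg] at h3
    rw [abs_of_nonneg (by linarith : 0 ≤ x - τ - 2 * n), abs_le]
    constructor <;> linarith

lemma psiFun_eq {x : ℝ} (n : ℤ) (h0 : 2 * n ≤ x) (h1 : x ≤ 2 * n + 1) : psiFun x = 2 * n := by
  unfold psiFun
  have : |x - 2 * n| = x - 2 * n := abs_of_nonneg (by linarith)
  rw [triWave_eq n (by rw [this]; linarith), this]; ring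

lemma psiTilde_zero {x : ℝ} (n : ℤ) (h0 : 2 * n - 1 ≤ x) (h1 : x ≤ 2 * n) : psiTilde x = 0 := by
  have := psiFun_eq (x := x + 1) n (by linarith) (by linarith)
  unfold psiTilde
  unfold psiFun at this
  rw [this, triWave_eq n (by simp)]; simp

lemma psiTilde_aux {x : ℝ} (n : ℤ) (h0 : 2 * n ≤ x) (h1 : x ≤ 2 * n + 1) :
    psiTilde x = triWave (2 * x - 2 * n) := by
  unfold psiTilde
  have : |x + 1 - 2 * ((n + 1 : ℤ) : ℝ)| = 2 * n + 1 - x := by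
    push_cast; rw [abs_of_nonpos (by linarith)]; ring
  rw [triWave_eq (x := x + 1) (n + 1) (by rw [this]; linarith), this]
  congr 1; ring

lemma psiTilde_up {x : ℝ} (n : ℤ) (h0 : 2 * n ≤ x) (h1 : x ≤ 2 * n + 1 / 2) :
    psiTilde x = 2 * (x - 2 * n) := by
  rw [psiTilde_aux n h0 (by linarith)]
  have : |2 * x - 2 * n - 2 * n| = 2 * (x - 2 * n) := by
    rw [abs_of_nonneg (by linarith)]; ring
  rw [triWave_eq n (by rw [this]; linarith), this]

lemma psiTilde_down {x : ℝ} (n : ℤ) (h0 : 2 * n + 1 / 2 ≤ x) (h1 : x ≤ 2 * n + 1) :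
    psiTilde x = 2 - 2 * (x - 2 * n) := by
  rw [psiTilde_aux n (by linarith) h1]
  have : |2 * x - 2 * n - 2 * ((n + 1 : ℤ) : ℝ)| = 2 - 2 * (x - 2 * n) := by
    push_cast; rw [abs_of_nonpos (by linarith)]; ring
  rw [triWave_eq (n + 1) (by rw [this]; linarith), this]

lemma psiTilde_nonneg (x : ℝ) : 0 ≤ psiTilde x := triWave_nonneg _
lemma psiTilde_le_one (x : ℝ) : psiTilde x ≤ 1 := triWave_le_one _

lemma psiTilde_sum (y : ℝ) : psiTilde (y + 1 / 2) + psiTilde (y + 1) + psiTilde (y + 3 / 2)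
    + psiTilde (y + 2) = 1 := by
  have hf := Int.floor_le (y / 2)
  have hf' := Int.lt_floor_add_one (y / 2)
  generalize ⌊y / 2⌋ = n at *
  have hc : ((n + 1 : ℤ) : ℝ) = n + 1 := by push_cast; rfl
  rcases le_total y (2 * n + 1) with h | h
  · rcases le_total y (2 * n + 1 / 2) with h' | h'
    · rw [psiTilde_down (x := y + 1 / 2) n (by linarith) (by linarith),
        psiTilde_zero (x := y + 1) (n + 1) (by linarith) (by linarith),
        psiTilde_zero (x := y + 3 / 2) (n + 1) (by linarith) (by linarith),
        psiTilde_up (x := y + 2) (n + 1) (by linarith) (by linarith), hc]; ring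
    · rw [psiTilde_zero (x := y + 1 / 2) (n + 1) (by linarith) (by linarith),
        psiTilde_zero (x := y + 1) (n + 1) (by linarith) (by linarith),
        psiTilde_up (x := y + 3 / 2) (n + 1) (by linarith) (by linarith),
        psiTilde_down (x := y + 2) (n + 1) (by linarith) (by linarith), hc]; ring
  · have hc2 : ((n + 2 : ℤ) : ℝ) = n + 2 := by push_cast; rfl
    rcases le_total y (2 * n + 3 / 2) with h' | h'
    · rw [psiTilde_zero (x := y + 1 / 2) (n + 1) (by linarith) (by linarith),
        psiTilde_up (x := y + 1) (n + 1) (by linarith) (by linarith),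
        psiTilde_down (x := y + 3 / 2) (n + 1) (by linarith) (by linarith),
        psiTilde_zero (x := y + 2) (n + 2) (by linarith) (by linarith), hc]; ring
    · rw [psiTilde_up (x := y + 1 / 2) (n + 1) (by linarith) (by linarith),
        psiTilde_down (x := y + 1) (n + 1) (by linarith) (by linarith),
        psiTilde_zero (x := y + 3 / 2) (n + 2) (by linarith) (by linarith),
        psiTilde_zero (x := y + 2) (n + 2) (by linarith) (by linarith), hc]; ring

end Helpers

/-- **One-dimensional uniform approximation on `[0, 1/2]` by a fixed-size `ρ`-network.**
If `ρ` is real analytic and non-polynomial on `(α, β)`, twice continuously differentiable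
near some `x₀` with `ρ''(x₀) ≠ 0`, and `f` is continuous on `[0, 1/2]`, then for every
`ε > 0` there exist `K ∈ ℕ⁺`, `δ ≠ 0`, and reals `uᵢ, vᵢ, wᵢ, w₀ᵢ` (`i = 1,…,4`) such that
`|Σ_{i=1}^4 Γ_δ(φᵢ(x + i/(4K)), ψ̃(2Kx + i/2)) - f(x)| < ε` on `[0, 1/2]`, where
`φᵢ(t) = uᵢ·g(wᵢ·ρ((α+β)/2 + (ψ(2Kt)/2 + 1)·w₀ᵢ)) + vᵢ` and
`Γ_δ(x,y) = (ρ(x₀+δx+δy) - ρ(x₀+δy) - ρ(x₀+δx) + ρ(x₀))/(δ²·ρ''(x₀))`. -/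
theorem approx_on_unit_half_interval
    (ρ : ℝ → ℝ) (α β : ℝ) (hαβ : α < β)
    (hanal : AnalyticOnNhd ℝ ρ (Ioo α β))
    (hnonpoly : ¬ ∃ p : Polynomial ℝ, ∀ x ∈ Ioo α β, ρ x = p.eval x)
    (x₀ : ℝ) (hsmooth : ∃ s ∈ nhds x₀, ContDiffOn ℝ 2 ρ s)
    (hρ'' : deriv (deriv ρ) x₀ ≠ 0)
    (f : ℝ → ℝ) (hf : ContinuousOn f (Icc (0 : ℝ) (1 / 2)))
    (ε : ℝ) (hε : 0 < ε) :
    ∃ K : ℕ, 0 < K ∧ ∃ δ : ℝ, δ ≠ 0 ∧ ∃ u v w w₀ : Fin 4 → ℝ,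
      ∀ x ∈ Icc (0 : ℝ) (1 / 2),
        |(∑ i : Fin 4,
            (fun a b : ℝ =>
              (ρ (x₀ + δ * a + δ * b) - ρ (x₀ + δ * b) - ρ (x₀ + δ * a) + ρ x₀) /
                (δ ^ 2 * deriv (deriv ρ) x₀))
            (u i * triWave (w i * ρ ((α + β) / 2 +
                (psiFun (2 * K * (x + ((i : ℕ) + 1) / (4 * K))) / 2 + 1) * w₀ i)) + v i)
            (psiTilde (2 * K * x + ((i : ℕ) + 1) / 2))) - f x| < ε := by
  classical
  -- clamping and uniform continuity
  have hcl : ∀ t : ℝ, max 0 (min (1 / 2) t) ∈ Icc (0 : ℝ) (1 / 2) := fun t =>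
    ⟨le_max_left _ _, max_le (by norm_num) (min_le_left _ _)⟩
  obtain ⟨C, hC⟩ := isCompact_Icc.exists_bound_of_continuousOn hf
  obtain ⟨M, hM1, hM⟩ : ∃ M : ℝ, 1 ≤ M ∧ ∀ x ∈ Icc (0 : ℝ) (1 / 2), |f x| ≤ M :=
    ⟨max C 1, le_max_right _ _, fun x hx => (hC x hx).trans (le_max_left _ _)⟩
  have huc := isCompact_Icc.uniformContinuousOn_of_continuous hf
  obtain ⟨d, hd, hfd⟩ := Metric.uniformContinuousOn_iff.1 huc (ε / 4) (by positivity)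
  obtain ⟨K', hK'⟩ := exists_nat_one_div_lt hd
  obtain ⟨K, hK0, hK⟩ : ∃ K : ℕ, 0 < K ∧ 1 / (K : ℝ) < d :=
    ⟨K' + 1, Nat.succ_pos _, by push_cast; exact hK'⟩
  have hKR : (0 : ℝ) < K := by exact_mod_cast hK0
  obtain ⟨w0, hw0⟩ := exists_indep hαβ hanal hnonpoly (K + 3)
  -- sample values
  let p : Fin 4 → Fin (K + 3) → ℝ := fun i k =>
    max 0 (min (1 / 2) ((2 * (k : ℕ) - ((i : ℕ) + 1) / 2) / (2 * K)))
  let τ : Fin 4 → Fin (K + 3) → ℝ := fun i k => (f (p i k) + M) / (2 * M)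
  have hτ : ∀ i k, 0 ≤ τ i k ∧ τ i k ≤ 1 := by
    intro i k
    have := abs_le.1 (hM _ (hcl ((2 * (k : ℕ) - ((i : ℕ) + 1) / 2) / (2 * K))))
    refine ⟨div_nonneg (by simp only [p]; linarith) (by linarith), ?_⟩
    rw [div_le_one (by linarith)]
    simp only [p]; linarith
  have hkr : ∀ i : Fin 4, ∃ t : ℝ, ∀ k : Fin (K + 3), ∃ n : ℤ,
      |t * ρ ((α + β) / 2 + ((k : ℕ) + 1) * w0) - τ i k / 2 - n| < ε / (16 * M) := fun i =>
    kronecker _ hw0 _ (by positivity)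
  choose t ht using hkr
  obtain ⟨δ, hδ, hΓ⟩ := gamma_approx hsmooth hρ'' (R := M) (η := ε / 16) (by linarith) (by positivity)
  refine ⟨K, hK0, δ, hδ, fun _ => 2 * M, fun _ => -M, fun i => 2 * t i, fun _ => w0, fun x hx => ?_⟩
  have hterm : ∀ i : Fin 4, |(fun a b : ℝ =>
              (ρ (x₀ + δ * a + δ * b) - ρ (x₀ + δ * b) - ρ (x₀ + δ * a) + ρ x₀) /
                (δ ^ 2 * deriv (deriv ρ) x₀))
            (2 * M * triWave (2 * t i * ρ ((α + β) / 2 +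
                (psiFun (2 * K * (x + ((i : ℕ) + 1) / (4 * K))) / 2 + 1) * w0)) + -M)
            (psiTilde (2 * K * x + ((i : ℕ) + 1) / 2))
            - f x * psiTilde (2 * K * x + ((i : ℕ) + 1) / 2)| ≤
            ε / 16 + ε / 2 * psiTilde (2 * K * x + ((i : ℕ) + 1) / 2) := by
    intro i
    have hi : ((i : ℕ) : ℝ) ≤ 3 := by
      have : (i : ℕ) ≤ 3 := by omega
      exact_mod_cast this
    have hi0 : (0 : ℝ) ≤ ((i : ℕ) : ℝ) := by positivity
    have harg : 2 * (K : ℝ) * (x + ((i : ℕ) + 1) / (4 * K)) = 2 * K * x + ((i : ℕ) + 1) / 2 := by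
      field_simp; ring
    rw [harg]
    set Y : ℝ := 2 * K * x + ((i : ℕ) + 1) / 2 with hY
    have hY0 : 1 / 2 ≤ Y := by
      have : 0 ≤ 2 * K * x := mul_nonneg (by positivity) hx.1
      linarith
    have hY1 : Y ≤ K + 2 := by
      have : 2 * K * x ≤ 2 * K * (1 / 2) := by gcongr; exact hx.2
      linarith
    have hb0 := psiTilde_nonneg Y
    have hb1 := psiTilde_le_one Y
    set a : ℝ := 2 * M * triWave (2 * t i * ρ ((α + β) / 2 + (psiFun Y / 2 + 1) * w0)) + -M with ha
    have haM : |a| ≤ M := by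
      have g0 := triWave_nonneg (2 * t i * ρ ((α + β) / 2 + (psiFun Y / 2 + 1) * w0))
      have g1 := triWave_le_one (2 * t i * ρ ((α + β) / 2 + (psiFun Y / 2 + 1) * w0))
      rw [abs_le, ha]
      constructor <;> nlinarith
    have hG := hΓ a (psiTilde Y) haM (by rw [abs_of_nonneg hb0]; linarith)
    have hprod : |a * psiTilde Y - f x * psiTilde Y| ≤ ε / 2 * psiTilde Y := by
      have hfl := Int.floor_le (Y / 2)
      have hfl' := Int.lt_floor_add_one (Y / 2)
      generalize ⌊Y / 2⌋ = n at *
      rcases le_total (2 * (n : ℝ) + 1) Y with h | h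
      · have : psiTilde Y = 0 := psiTilde_zero (n + 1) (by push_cast; linarith) (by push_cast; linarith)
        simp [this]
      · have hn0 : 0 ≤ n := by
          have : (-1 : ℝ) < n := by linarith
          have : (-1 : ℤ) < n := by exact_mod_cast this
          omega
        obtain ⟨k, rfl⟩ := Int.eq_ofNat_of_zero_le hn0
        rw [Int.cast_natCast] at *
        have hk : k < K + 3 := by
          have : (k : ℝ) < K + 3 := by linarith
          exact_mod_cast this
        have hpsi : psiFun Y = 2 * k := by
          have := psiFun_eq (x := Y) (k : ℤ) (by push_cast; linarith) (by push_cast; linarith)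
          simpa using this
        obtain ⟨n, hn⟩ := ht i ⟨k, hk⟩
        have hτk := hτ i ⟨k, hk⟩
        have e1 : a = 2 * M * triWave (2 * t i * ρ ((α + β) / 2 + ((k : ℝ) + 1) * w0)) + -M := by
          rw [ha, hpsi]
          congr 5; ring
        have e2 := triWave_sub_le (x := 2 * t i * ρ ((α + β) / 2 + ((k : ℝ) + 1) * w0)) n hτk.1 hτk.2
        simp only at hn
        have e3 : |2 * t i * ρ ((α + β) / 2 + ((k : ℝ) + 1) * w0) - τ i ⟨k, hk⟩ - 2 * n|
            < 2 * (ε / (16 * M)) := by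
          rw [show 2 * t i * ρ ((α + β) / 2 + ((k : ℝ) + 1) * w0) - τ i ⟨k, hk⟩ - 2 * n =
            2 * (t i * ρ ((α + β) / 2 + ((k : ℝ) + 1) * w0) - τ i ⟨k, hk⟩ / 2 - n) by ring,
            abs_mul, abs_two]
          linarith
        have hfp : 2 * M * τ i ⟨k, hk⟩ + -M = f (p i ⟨k, hk⟩) := by
          simp only [τ]; field_simp; ring
        have e4 : |a - f (p i ⟨k, hk⟩)| ≤ ε / 4 := by
          rw [← hfp, e1, show ∀ u v : ℝ, 2 * M * u + -M - (2 * M * v + -M) = 2 * M * (u - v) by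
            intros; ring, abs_mul, abs_of_pos (by linarith : 0 < 2 * M)]
          calc _ ≤ 2 * M * (2 * (ε / (16 * M))) := by gcongr; linarith
            _ = ε / 4 := by field_simp; ring
        have e5 : |f (p i ⟨k, hk⟩) - f x| ≤ ε / 4 := by
          have hdist : dist (p i ⟨k, hk⟩) x < d := by
            have hq : x - (2 * (k : ℝ) - ((i : ℕ) + 1) / 2) / (2 * K) = (Y - 2 * k) / (2 * K) := by
              rw [hY]; field_simp; ring
            have hq0 : 0 ≤ (Y - 2 * k) / (2 * K) := div_nonneg (by linarith) (by positivity)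
            have hq1 : (Y - 2 * k) / (2 * K) ≤ 1 / K := by
              rw [div_le_div_iff₀ (by positivity) hKR]; nlinarith
            simp only [p]
            set q := (2 * (k : ℝ) - ((i : ℕ) + 1) / 2) / (2 * K) with hqdef
            have hqx : q ≤ 1 / 2 := by linarith [hx.2]
            rw [min_eq_right hqx, Real.dist_eq, abs_lt]
            have m1 : q ≤ max 0 q := le_max_right _ _
            have m2 : max 0 q ≤ x := max_le hx.1 (by linarith)
            constructor <;> linarith
          have := hfd _ (hcl _) x hx hdist
          rw [Real.dist_eq] at this
          exact this.le
        rw [← sub_mul, abs_mul, abs_of_nonneg hb0]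
        gcongr
        calc |a - f x| = |(a - f (p i ⟨k, hk⟩)) + (f (p i ⟨k, hk⟩) - f x)| := by ring_nf
          _ ≤ _ := abs_add_le _ _
          _ ≤ ε / 2 := by linarith
    have := abs_le.1 hG
    have := abs_le.1 hprod
    rw [abs_le]
    constructor <;> linarith
  have hsum : ∑ i : Fin 4, psiTilde (2 * K * x + ((i : ℕ) + 1) / 2) = 1 := by
    rw [Fin.sum_univ_four]
    have := psiTilde_sum (2 * K * x)
    refine Eq.trans ?_ this
    norm_num
  have hfx : f x = ∑ i : Fin 4, f x * psiTilde (2 * K * x + ((i : ℕ) + 1) / 2) := by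
    rw [← Finset.mul_sum, hsum, mul_one]
  rw [hfx, ← Finset.sum_sub_distrib]
  refine (Finset.abs_sum_le_sum_abs _ _).trans_lt ?_
  refine (Finset.sum_le_sum fun i _ => hterm i).trans_lt ?_
  rw [Finset.sum_add_distrib, ← Finset.mul_sum, hsum]
  simp only [Finset.sum_const, Finset.card_univ, Fintype.card_fin, nsmul_eq_mul]
  push_cast
  linarith
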